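/- Let (C,λ) be a (p⁺,N₀)-divergent LMC, F = λ⁻¹([0,N₀]), α the restriction of λ to S ∖ Av_C(F), 1/2 < p < p⁺, and C' the biased Markov chain of the abstraction (C,F) →^α (W^p, [0,N₀]). Then there exists N₁ ≥ N₀ such that α⁻¹([0,N₁]) ∪ {s₋} is a finite attractor in C'; consequently C' is decisive with respect to any T ⊆ F. -/

import Mathlib

open scoped ENNReal NNReal BigOperators
open Filter

noncomputable section

variable {S : Type*}

/-- Probability of following a finite path (list of successive states). -/
def pathProb (P : S → S → ℝ≥0∞) : List S → ℝ≥0∞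
  | [] => 1
  | [_] => 1
  | a :: b :: l => P a b * pathProb P (b :: l)

/-- `l` is a finite path starting at `s` that visits `T` for the first time
at its last element. -/
def FirstHitPath (T : Set S) (s : S) (l : List S) : Prop :=
  l.head? = some s ∧ ∃ h : l ≠ [], l.getLast h ∈ T ∧
    ∀ i : Fin l.length, (i : ℕ) + 1 < l.length → l.get i ∉ T

/-- Probability of eventually reaching `T` from `s`. -/
def reachProb (P : S → S → ℝ≥0∞) (T : Set S) (s : S) : ℝ≥0∞ :=
  ∑' l : {l : List S // FirstHitPath T s l}, pathProb P (l : List S)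

/-- The avoid set: states from which `T` is unreachable. -/
def Av (P : S → S → ℝ≥0∞) (T : Set S) : Set S := {s | reachProb P T s = 0}

/-- Probability that, starting from `s`, the chain stays outside `R`
during its first `n` steps (i.e. the hitting time of `R` is `> n`). -/
def surviveProb (P : S → S → ℝ≥0∞) (R : Set S) (s : S) (n : ℕ) : ℝ≥0∞ :=
  ∑' l : {l : List S // l.length = n + 1 ∧ l.head? = some s ∧ ∀ x ∈ l, x ∉ R},
    pathProb P (l : List S)

/-- Expected hitting time of `R` from `s`, via `E τ = ∑_{n≥0} Pr(τ > n)`. -/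
def expHittingTime (P : S → S → ℝ≥0∞) (R : Set S) (s : S) : ℝ≥0∞ :=
  ∑' n : ℕ, surviveProb P R s n

/-- Probability that `X_i ∈ A` for all `i ≥ m`, starting from `s`
(as the infimum over finite horizons). -/
def confineProb (P : S → S → ℝ≥0∞) (A : Set S) (s : S) (m : ℕ) : ℝ≥0∞ :=
  ⨅ n : ℕ, ∑' l : {l : List S // l.length = n + 1 ∧ l.head? = some s ∧
      ∀ i : Fin l.length, m ≤ (i : ℕ) → l.get i ∈ A}, pathProb P (l : List S)

/-- Expected reward collected at the first visit of `T`. -/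
def expReward (P : S → S → ℝ≥0∞) (L : List S → ℝ≥0∞) (T : Set S) (s : S) : ℝ≥0∞ :=
  ∑' l : {l : List S // FirstHitPath T s l}, L l * pathProb P (l : List S)

/-- `P` is a stochastic matrix. -/
def IsStochastic (P : S → S → ℝ≥0∞) : Prop := ∀ s, ∑' s', P s s' = 1

/-- States of the biased chain other than `s₋`. -/
abbrev SA (P : S → S → ℝ≥0∞) (F : Set S) := {s : S // s ∉ Av P F}

/-- `P'` (on `(S ∖ Av(F)) ⊎ {s₋}`, with `none = s₋`) is a biased Markov chain
of `(C, T, F)`. -/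
def IsBiased (P : S → S → ℝ≥0∞) (T F : Set S)
    (P' : Option (SA P F) → Option (SA P F) → ℝ≥0∞) : Prop :=
  IsStochastic P' ∧
  P' none none = 1 ∧
  (∀ s : SA P F, s.val ∈ T → P' (some s) (some s) = 1) ∧
  (∀ s s' : SA P F, 0 < P s.val s'.val → 0 < P' (some s) (some s'))

/-- `(C^•, F^•)` together with `α` is an abstraction of `(C, F)`. -/
def IsAbstraction (P : S → S → ℝ≥0∞) (F : Set S)
    {S' : Type*} (P' : S' → S' → ℝ≥0∞) (F' : Set S')
    (α : SA P F → S') : Prop :=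
  (∀ s : SA P F, s.val ∈ F → α s ∈ F') ∧
  (∀ s : SA P F, s.val ∉ F →
    ∑' s' : SA P F, P s.val s'.val * reachProb P' F' (α s')
      ≤ reachProb P' F' (α s))

/-- The decreasing ratio `h(s)` of an abstraction. -/
def hRatio (P : S → S → ℝ≥0∞) (F : Set S)
    {S' : Type*} (P' : S' → S' → ℝ≥0∞) (F' : Set S')
    (α : SA P F → S') (s : SA P F) : ℝ≥0∞ :=
  (∑' s' : SA P F, P s.val s'.val * reachProb P' F' (α s'))
    / reachProb P' F' (α s)

/-- The biased Markov chain constructed from an abstraction. -/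
def biasedKernel (P : S → S → ℝ≥0∞) (F : Set S)
    {S' : Type*} (P' : S' → S' → ℝ≥0∞) (F' : Set S')
    (α : SA P F → S') :
    Option (SA P F) → Option (SA P F) → ℝ≥0∞
  | none, none => 1
  | none, some _ => 0
  | some s, none => 1 - hRatio P F P' F' α s
  | some s, some s' =>
      P s.val s'.val * reachProb P' F' (α s') / reachProb P' F' (α s)

/-- The random walk `W^p` on `ℕ`: `0` absorbing, up with probability `p`,
down with probability `1 - p`. -/
def walkKernel (p : ℝ≥0∞) : ℕ → ℕ → ℝ≥0∞ := fun m n =>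
  if m = 0 then (if n = 0 then 1 else 0)
  else if n = m + 1 then p
  else if n + 1 = m then 1 - p
  else 0

/-- `(C, λ)` is a layered Markov chain. -/
def IsLMC (P : S → S → ℝ≥0∞) (lam : S → ℕ) : Prop :=
  (∀ s s', 0 < P s s' → (lam s : ℤ) ≤ (lam s' : ℤ) + 1) ∧
  (∀ n : ℕ, {s : S | lam s = n}.Finite)

/-- Total probability of increasing the level. -/
def Pup (P : S → S → ℝ≥0∞) (lam : S → ℕ) (s : S) : ℝ≥0∞ :=
  ∑' s' : {s' : S // lam s < lam s'}, P s s'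

/-- Total probability of decreasing the level (by one). -/
def Pdown (P : S → S → ℝ≥0∞) (lam : S → ℕ) (s : S) : ℝ≥0∞ :=
  ∑' s' : {s' : S // lam s' + 1 = lam s}, P s s'

/-- Total probability of keeping the same level. -/
def Peq (P : S → S → ℝ≥0∞) (lam : S → ℕ) (s : S) : ℝ≥0∞ :=
  ∑' s' : {s' : S // lam s' = lam s}, P s s'

/-- `(C, λ)` is `(p⁺, N₀)`-divergent. -/
def Divergent (P : S → S → ℝ≥0∞) (lam : S → ℕ) (pplus : ℝ≥0∞) (N₀ : ℕ) : Prop :=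
  1/2 < pplus ∧ ∀ s : S, N₀ < lam s → Peq P lam s < 1 →
    pplus ≤ Pup P lam s / (Pdown P lam s + Pup P lam s)

end

open scoped Classical


section Helpers

theorem aux_tsum_option {α : Type*} (g : Option α → ℝ≥0∞) :
    ∑' x, g x = g none + ∑' a, g (some a) := by
  rw [ENNReal.tsum_eq_add_tsum_ite none]
  congr 1
  rw [← (Option.some_injective α).tsum_eq]
  · simp
  · intro x hx
    cases x with
    | none => simp at hx
    | some a => exact ⟨a, rfl⟩

def auxListEquiv (α : Type*) : Option (α × List α) ≃ List α where
  toFun x := match x with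
    | none => []
    | some (a, l) => a :: l
  invFun l := match l with
    | [] => none
    | a :: l => some (a, l)
  left_inv x := by rcases x with _ | ⟨a, l⟩ <;> rfl
  right_inv l := by cases l <;> rfl

theorem aux_tsum_list {α : Type*} (g : List α → ℝ≥0∞) :
    ∑' l, g l = g [] + ∑' a, ∑' l, g (a :: l) := by
  rw [← (auxListEquiv α).tsum_eq, aux_tsum_option, ENNReal.tsum_prod']
  rfl

/-- one-step operator killed on `T` -/
noncomputable def stepK {X : Type*} (P : X → X → ℝ≥0∞) (T : Set X) (f : X → ℝ≥0∞) (s : X) : ℝ≥0∞ :=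
  if s ∈ T then 0 else ∑' s', P s s' * f s'

noncomputable def hitAt {X : Type*} (P : X → X → ℝ≥0∞) (T : Set X) : ℕ → X → ℝ≥0∞
  | 0 => fun s => if s ∈ T then 1 else 0
  | n + 1 => stepK P T (hitAt P T n)

noncomputable def surv {X : Type*} (P : X → X → ℝ≥0∞) (T : Set X) : ℕ → X → ℝ≥0∞
  | 0 => fun s => if s ∈ T then 0 else 1
  | n + 1 => stepK P T (surv P T n)

theorem aux_fhp_single {X : Type*} (T : Set X) (s a : X) :
    FirstHitPath T s [a] ↔ a = s ∧ a ∈ T := by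
  simp [FirstHitPath]

theorem aux_fhp_cons {X : Type*} (T : Set X) (s a b : X) (l : List X) :
    FirstHitPath T s (a :: b :: l) ↔ a = s ∧ a ∉ T ∧ FirstHitPath T b (b :: l) := by
  unfold FirstHitPath
  simp only [List.head?_cons, Option.some.injEq, ne_eq, reduceCtorEq, not_false_eq_true,
    List.getLast_cons_cons, exists_true_left, true_and, List.length_cons]
  constructor
  · rintro ⟨h1, h2, h3⟩
    refine ⟨h1, ?_, h2, ?_⟩
    · simpa using h3 ⟨0, by simp⟩ (by simp)
    · intro i hi
      have := h3 ⟨i.1 + 1, by have := i.2; simp at this ⊢; omega⟩ (by simp; omega)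
      simpa using this
  · rintro ⟨h1, h2, h3, h4⟩
    refine ⟨h1, h3, ?_⟩
    rintro ⟨i, hi⟩ hi'
    cases i with
    | zero => simpa using h2
    | succ j =>
      have := h4 ⟨j, by simp at hi ⊢; omega⟩ (by simp at hi' ⊢; omega)
      simpa using this

noncomputable def hitW {X : Type*} (P : X → X → ℝ≥0∞) (T : Set X) (n : ℕ) (s : X) : ℝ≥0∞ :=
  ∑' l : List X, if FirstHitPath T s l ∧ l.length = n + 1 then pathProb P l else 0

theorem aux_hitW_cons {X : Type*} (P : X → X → ℝ≥0∞) (T : Set X) (n : ℕ) (s : X) :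
    hitW P T n s = ∑' l : List X,
      if FirstHitPath T s (s :: l) ∧ l.length = n then pathProb P (s :: l) else 0 := by
  unfold hitW
  rw [aux_tsum_list, tsum_eq_single s]
  · simp
  · intro b hb
    rw [ENNReal.tsum_eq_zero]
    intro l
    rw [if_neg]
    rintro ⟨⟨h, -⟩, -⟩
    simp at h
    exact hb h

theorem aux_hitW_eq {X : Type*} (P : X → X → ℝ≥0∞) (T : Set X) (n : ℕ) :
    ∀ s, hitW P T n s = hitAt P T n s := by
  induction n with
  | zero =>
    intro s
    rw [aux_hitW_cons, aux_tsum_list]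
    simp [aux_fhp_single, pathProb, hitAt]
  | succ n ih =>
    intro s
    rw [aux_hitW_cons, aux_tsum_list]
    simp only [hitAt, stepK, List.length_nil, List.length_cons, aux_fhp_cons]
    rw [if_neg (by simp), zero_add]
    by_cases hs : s ∈ T
    · simp [hs]
    · simp only [hs, if_false]
      congr 1
      ext a
      rw [← ih, aux_hitW_cons, ← ENNReal.tsum_mul_left]
      congr 1
      ext l
      simp [pathProb]

theorem reach_eq {X : Type*} (P : X → X → ℝ≥0∞) (T : Set X) (s : X) :
    reachProb P T s = ∑' n, hitAt P T n s := by
  simp_rw [← aux_hitW_eq]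
  unfold hitW reachProb
  rw [ENNReal.tsum_comm]
  have := tsum_subtype {l | FirstHitPath T s l} (fun l => pathProb P l)
  refine this.trans ?_
  congr 1
  ext l
  by_cases h : FirstHitPath T s l
  · have hl : l ≠ [] := h.2.1
    rw [tsum_eq_single (l.length - 1)]
    · have : l.length = l.length - 1 + 1 := by
        have := List.length_pos_iff.2 hl
        omega
      simp [Set.indicator, h, ← this]
    · intro b hb
      rw [if_neg]
      rintro ⟨-, h⟩
      omega
  · simp [Set.indicator, h]

theorem stepK_mono {X : Type*} (P : X → X → ℝ≥0∞) (T : Set X) {f g : X → ℝ≥0∞}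
    (h : ∀ x, f x ≤ g x) (s : X) : stepK P T f s ≤ stepK P T g s := by
  unfold stepK
  split_ifs
  · exact le_rfl
  · exact ENNReal.tsum_le_tsum fun a => mul_le_mul_right (h a) _

noncomputable def hitLe {X : Type*} (P : X → X → ℝ≥0∞) (T : Set X) (n : ℕ) (s : X) : ℝ≥0∞ :=
  ∑ k ∈ Finset.range (n + 1), hitAt P T k s

theorem hitLe_zero {X : Type*} (P : X → X → ℝ≥0∞) (T : Set X) (s : X) :
    hitLe P T 0 s = if s ∈ T then 1 else 0 := by
  simp [hitLe, hitAt]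

theorem hitLe_succ {X : Type*} (P : X → X → ℝ≥0∞) (T : Set X) (n : ℕ) (s : X) :
    hitLe P T (n + 1) s = if s ∈ T then 1 else ∑' s', P s s' * hitLe P T n s' := by
  unfold hitLe
  rw [Finset.sum_range_succ']
  simp only [hitAt, stepK]
  split_ifs with h
  · simp
  · rw [add_zero]
    simp_rw [Finset.mul_sum]
    rw [Summable.tsum_finsetSum]
    intros; exact ENNReal.summable

theorem hitLe_le_reach {X : Type*} (P : X → X → ℝ≥0∞) (T : Set X) (n : ℕ) (s : X) :
    hitLe P T n s ≤ reachProb P T s := by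
  rw [reach_eq]; exact ENNReal.sum_le_tsum _

theorem reach_le_of_hitLe {X : Type*} (P : X → X → ℝ≥0∞) (T : Set X) (s : X) (c : ℝ≥0∞)
    (h : ∀ n, hitLe P T n s ≤ c) : reachProb P T s ≤ c := by
  rw [reach_eq, ENNReal.tsum_eq_iSup_nat]
  refine iSup_le fun n => le_trans ?_ (h n)
  exact Finset.sum_le_sum_of_subset (by simp)

theorem reach_step {X : Type*} (P : X → X → ℝ≥0∞) (T : Set X) (s : X) :
    reachProb P T s = if s ∈ T then 1 else ∑' s', P s s' * reachProb P T s' := by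
  rw [reach_eq, tsum_eq_zero_add' ENNReal.summable]
  simp only [hitAt, stepK]
  split_ifs with h
  · simp
  · rw [zero_add, ENNReal.tsum_comm]
    simp_rw [reach_eq, ENNReal.tsum_mul_left]

theorem hit_add_surv {X : Type*} (P : X → X → ℝ≥0∞) (hP : IsStochastic P) (T : Set X) (n : ℕ) :
    ∀ s, hitLe P T n s + surv P T n s = 1 := by
  induction n with
  | zero => intro s; rw [hitLe_zero]; simp only [surv]; split_ifs <;> simp
  | succ n ih =>
    intro s
    rw [hitLe_succ]; simp only [surv, stepK]
    split_ifs
    · simp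
    · rw [← ENNReal.tsum_add]
      simp_rw [← mul_add, ih, mul_one]
      exact hP s

theorem reach_le_one {X : Type*} (P : X → X → ℝ≥0∞) (hP : IsStochastic P) (T : Set X) (s : X) :
    reachProb P T s ≤ 1 :=
  reach_le_of_hitLe _ _ _ _ fun n => by
    rw [← hit_add_surv P hP T n s]; exact le_self_add

theorem reach_eq_one {X : Type*} (P : X → X → ℝ≥0∞) (hP : IsStochastic P) (T : Set X) (s : X)
    (h : Tendsto (fun n => surv P T n s) atTop (nhds 0)) : reachProb P T s = 1 := by
  refine le_antisymm (reach_le_one P hP T s) ?_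
  have h2 : Tendsto (fun n => reachProb P T s + surv P T n s) atTop (nhds (reachProb P T s + 0)) :=
    tendsto_const_nhds.add h
  rw [add_zero] at h2
  refine ge_of_tendsto' h2 fun n => ?_
  rw [← hit_add_surv P hP T n s]
  exact add_le_add_left (hitLe_le_reach P T n s) _

theorem superharm {X : Type*} (P : X → X → ℝ≥0∞) (A : Set X) (v : X → ℝ≥0∞) (m : ℝ≥0∞)
    (hv : ∀ x, x ∉ A → ∑' y, P x y * v y ≤ v x) (hA : ∀ x ∈ A, m ≤ v x) (x : X) :
    m * reachProb P A x ≤ v x := by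
  have key : ∀ n x, m * hitLe P A n x ≤ v x := by
    intro n
    induction n with
    | zero =>
      intro x; rw [hitLe_zero]; split_ifs with h
      · simpa using hA x h
      · simp
    | succ n ih =>
      intro x; rw [hitLe_succ]; split_ifs with h
      · simpa using hA x h
      · refine le_trans ?_ (hv x h)
        rw [← ENNReal.tsum_mul_left]
        refine ENNReal.tsum_le_tsum fun y => ?_
        rw [mul_left_comm]
        exact mul_le_mul_right (ih y) _
  rw [reach_eq, ENNReal.tsum_eq_iSup_nat, ENNReal.mul_iSup]
  refine iSup_le fun n => le_trans ?_ (key n x)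
  exact mul_le_mul_right (Finset.sum_le_sum_of_subset (by simp)) _

theorem decisive {X : Type*} (P : X → X → ℝ≥0∞) (hP : IsStochastic P) (R T : Set X)
    (hR : R.Finite) (hne : R.Nonempty) (hreach : ∀ x, reachProb P R x = 1) (x : X) :
    reachProb P (T ∪ Av P T) x = 1 := by
  set D := T ∪ Av P T with hD
  set v := reachProb P D with hv
  have hv1 : ∀ x, v x ≤ 1 := reach_le_one P hP D
  have hsup : ∀ x, ∑' y, P x y * v y ≤ v x := by
    intro x
    rw [hv, reach_step P D x]
    split_ifs
    · calc _ ≤ ∑' y, P x y * 1 := ENNReal.tsum_le_tsum fun y => mul_le_mul_right (hv1 y) _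
        _ = 1 := by simp_rw [mul_one]; exact hP x
    · exact le_rfl
  obtain ⟨b, hbR, hb⟩ := Set.exists_min_image R v hR hne
  have hmin : ∀ x, v b ≤ v x := by
    intro x
    have := superharm P R v (v b) (fun x _ => hsup x) hb x
    rwa [hreach, mul_one] at this
  have hvD : ∀ x ∈ D, v x = 1 := by
    intro x hx
    rw [hv, reach_step, if_pos hx]
  suffices h : v b = 1 from le_antisymm (hv1 x) (h ▸ hmin x)
  by_cases hbD : b ∈ D
  · exact hvD b hbD
  have h1 : ∀ n x, hitLe P D n x + v b * surv P D n x ≤ v x := by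
    intro n
    induction n with
    | zero =>
      intro x; rw [hitLe_zero]; simp only [surv]; split_ifs with h
      · simp [hvD x h]
      · simpa using hmin x
    | succ n ih =>
      intro x; rw [hitLe_succ]; simp only [surv, stepK]; split_ifs with h
      · simp [hvD x h]
      · refine le_trans ?_ (hsup x)
        rw [← ENNReal.tsum_mul_left, ← ENNReal.tsum_add]
        refine ENNReal.tsum_le_tsum fun y => ?_
        rw [mul_left_comm, ← mul_add]
        exact mul_le_mul_right (ih y) _
  have hbT : 0 < v b := by
    have h2 := superharm P T v 1 (fun x _ => hsup x) (fun x hx => (hvD x (Or.inl hx)).ge) b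
    rw [one_mul] at h2
    refine lt_of_lt_of_le ?_ h2
    rw [pos_iff_ne_zero]
    intro h0
    exact hbD (Or.inr h0)
  obtain ⟨n, hn⟩ : ∃ n, hitLe P D n b ≠ 0 := by
    by_contra! hcon
    have := reach_le_of_hitLe P D b 0 (fun n => (hcon n).le)
    exact absurd hbT (not_lt.2 this)
  have e1 := hit_add_surv P hP D n b
  have e2 := h1 n b
  have f1 : hitLe P D n b ≠ ⊤ := by
    intro h; rw [h] at e1; simp at e1
  have f2 : surv P D n b ≠ ⊤ := by
    intro h; rw [h] at e1; simp at e1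
  have f3 : v b ≠ ⊤ := ne_top_of_le_ne_top ENNReal.one_ne_top (hv1 b)
  refine le_antisymm (hv1 b) ?_
  lift hitLe P D n b to ℝ≥0 using f1 with H
  lift surv P D n b to ℝ≥0 using f2 with W
  lift v b to ℝ≥0 using f3 with V
  norm_cast at *
  have hH : 0 < H := pos_iff_ne_zero.2 hn
  have e1' : (H : ℝ) + W = 1 := by exact_mod_cast e1
  have e2' : (H : ℝ) + V * W ≤ V := by exact_mod_cast e2
  have hH' : (0 : ℝ) < H := by exact_mod_cast hH
  have : (1 : ℝ) ≤ V := by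
    have : W = (1 : ℝ) - H := by linarith
    rw [this] at e2'
    by_contra hc
    nlinarith
  exact_mod_cast this

theorem walk_sum (p : ℝ≥0∞) (m : ℕ) (f : ℕ → ℝ≥0∞) :
    ∑' k, walkKernel p (m + 1) k * f k = p * f (m + 2) + (1 - p) * f m := by
  rw [tsum_eq_sum (s := {m, m + 2})]
  · rw [Finset.sum_pair (by omega)]
    have e1 : walkKernel p (m + 1) m = 1 - p := by
      simp [walkKernel, show m ≠ m + 1 + 1 by omega]
    have e2 : walkKernel p (m + 1) (m + 2) = p := by
      simp [walkKernel]
    rw [e1, e2, add_comm]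
  · intro b hb
    simp at hb
    have h1 : b ≠ m + 1 + 1 := hb.2
    simp [walkKernel, h1, hb.1]

theorem walk_stoch (p : ℝ≥0∞) (hp : p ≤ 1) : IsStochastic (walkKernel p) := by
  intro s
  cases s with
  | zero => simp [walkKernel]
  | succ m =>
    have := walk_sum p m (fun _ => 1)
    simp only [mul_one] at this
    rw [this, add_tsub_cancel_of_le hp]

theorem aux_harm (k : ℝ) (hk0 : 0 ≤ k) (hk1 : k < 1) (p : ℝ) (hp : 0 < p) (hkp : k * p = 1 - p)
    (w : ℕ → ℝ) (hw0 : w 0 = 1) (hw : ∀ j, w (j + 1) = p * w (j + 2) + (1 - p) * w j)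
    (hpos : ∀ j, 0 ≤ w j) (hle : ∀ j, w j ≤ k ^ j) (j : ℕ) : w j = k ^ j := by
  have hrec : ∀ j, w (j + 2) = (1 + k) * w (j + 1) - k * w j := by
    intro j
    have h1 := hw j
    have : p * (w (j + 2) - ((1 + k) * w (j + 1) - k * w j)) = 0 := by
      linear_combination -h1 + (w j - w (j + 1)) * hkp
    rcases mul_eq_zero.1 this with h | h
    · exact absurd h hp.ne'
    · linarith
  set c := w 1 - k with hc
  have key : ∀ j, (w j - k ^ j) * (1 - k) = c * (1 - k ^ j) ∧
      (w (j + 1) - k ^ (j + 1)) * (1 - k) = c * (1 - k ^ (j + 1)) := by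
    intro j
    induction j with
    | zero => constructor <;> simp [hw0, hc]
    | succ j ih =>
      refine ⟨ih.2, ?_⟩
      rw [hrec j]
      linear_combination (1 + k) * ih.2 - k * ih.1
  have hk : Tendsto (fun j : ℕ => k ^ j) atTop (nhds 0) := tendsto_pow_atTop_nhds_zero_of_lt_one hk0 hk1
  have hwt : Tendsto w atTop (nhds 0) := squeeze_zero hpos hle hk
  have l1 : Tendsto (fun j => (w j - k ^ j) * (1 - k)) atTop (nhds ((0 - 0) * (1 - k))) :=
    (hwt.sub hk).mul_const _
  have l2 : Tendsto (fun j => c * (1 - k ^ j)) atTop (nhds (c * (1 - 0))) :=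
    (tendsto_const_nhds.sub hk).const_mul c
  have l3 : (fun j => (w j - k ^ j) * (1 - k)) = fun j => c * (1 - k ^ j) := by
    ext j; exact (key j).1
  rw [l3] at l1
  have hc0 := tendsto_nhds_unique l1 l2
  have : c = 0 := by linarith
  have h := (key j).1
  rw [this, zero_mul] at h
  rcases mul_eq_zero.1 h with h | h <;> linarith

theorem aux_kappa (p : ℝ≥0∞) (hp1 : 1/2 < p) (hp2 : p < 1) :
    ∃ p' k' : ℝ≥0, p = p' ∧ (1 - p) / p = k' ∧ (1/2 : ℝ) < p' ∧ (p' : ℝ) < 1 ∧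
      (k' : ℝ) * p' = 1 - p' ∧ 0 < (k' : ℝ) ∧ (k' : ℝ) < 1 := by
  lift p to ℝ≥0 using hp2.ne_top with q
  have hq1 : (1/2 : ℝ) < q := by
    have := (ENNReal.toReal_lt_toReal (by simp) (by simp)).2 hp1
    simpa using this
  have hq2 : q < 1 := by exact_mod_cast hp2
  have hq2' : (q : ℝ) < 1 := by exact_mod_cast hq2
  have hq0 : q ≠ 0 := by
    rintro rfl
    norm_num at hq1
  refine ⟨q, (1 - q) / q, rfl, ?_, hq1, hq2', ?_, ?_, ?_⟩
  · rw [ENNReal.coe_div hq0]; simp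
  all_goals
    push_cast [NNReal.coe_sub hq2.le]
    have : (0 : ℝ) < q := by linarith
  · field_simp
  · apply div_pos <;> linarith
  · rw [div_lt_one this]; linarith

theorem walk_reach (p : ℝ≥0∞) (hp1 : 1/2 < p) (hp2 : p < 1) (N₀ n : ℕ) :
    reachProb (walkKernel p) (Set.Iic N₀) n = ((1 - p) / p) ^ (n - N₀) := by
  obtain ⟨q, k, rfl, hk, hq1, hq2, hkq, hk0, hk1⟩ := aux_kappa p hp1 hp2
  rw [hk]
  have h1q : (1 : ℝ≥0∞) - q = k * q := by
    have : (1 : ℝ≥0) - q = k * q := by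
      have hq : q ≤ 1 := by exact_mod_cast hq2.le
      rw [← NNReal.coe_inj, NNReal.coe_sub hq]; push_cast; exact hkq.symm
    exact_mod_cast congrArg ((↑) : ℝ≥0 → ℝ≥0∞) this
  set v := reachProb (walkKernel (q : ℝ≥0∞)) (Set.Iic N₀) with hv
  have hle1 : ∀ n, v n ≤ 1 := reach_le_one _ (walk_stoch _ hp2.le) _
  have hlow : ∀ n, n ≤ N₀ → v n = 1 := by
    intro n hn
    rw [hv, reach_step, if_pos (by simpa using hn)]
  have hstep : ∀ j, v (N₀ + (j + 1)) = q * v (N₀ + (j + 2)) + (1 - q) * v (N₀ + j) := by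
    intro j
    rw [hv, reach_step, if_neg (by simp)]
    exact walk_sum _ (N₀ + j) _
  have hup : ∀ n, v n ≤ (k : ℝ≥0∞) ^ (n - N₀) := by
    intro n
    have := superharm (walkKernel (q : ℝ≥0∞)) (Set.Iic N₀) (fun n => (k : ℝ≥0∞) ^ (n - N₀)) 1
      (by
        intro x hx
        simp only [Set.mem_Iic, not_le] at hx
        obtain ⟨j, rfl⟩ := Nat.exists_eq_add_of_lt hx
        rw [walk_sum, h1q]
        have e1 : N₀ + j + 2 - N₀ = j + 2 := by omega
        have e2 : N₀ + j + 1 - N₀ = j + 1 := by omega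
        have e3 : N₀ + j - N₀ = j := by omega
        rw [e1, e2, e3]
        apply le_of_eq
        have : q * k ^ (j + 2) + k * q * k ^ j = k ^ (j + 1) := by
          rw [← NNReal.coe_inj]; push_cast
          linear_combination (k : ℝ) ^ (j + 1) * hkq
        exact_mod_cast congrArg ((↑) : ℝ≥0 → ℝ≥0∞) this)
      (by
        intro x hx
        simp only [Set.mem_Iic] at hx
        simp [Nat.sub_eq_zero_of_le hx]) n
    simpa using this
  have hfin : ∀ n, v n ≠ ⊤ := fun n => ne_top_of_le_ne_top ENNReal.one_ne_top (hle1 n)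
  have main := aux_harm k hk0.le hk1 q (by linarith) hkq (fun j => (v (N₀ + j)).toReal)
    (by simp [hlow])
    (by
      intro j
      rw [hstep j, ENNReal.toReal_add, ENNReal.toReal_mul, ENNReal.toReal_mul, h1q]
      · simp [← hkq]
      · exact ENNReal.mul_ne_top (by simp) (hfin _)
      · exact ENNReal.mul_ne_top (by simp) (hfin _))
    (fun j => ENNReal.toReal_nonneg)
    (by
      intro j
      have := ENNReal.toReal_mono (by simp) (hup (N₀ + j))
      simpa using this)
  rcases le_total n N₀ with h | h
  · simp [hlow n h, Nat.sub_eq_zero_of_le h]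
  · obtain ⟨j, rfl⟩ := Nat.exists_eq_add_of_le h
    rw [← ENNReal.toReal_eq_toReal_iff' (hfin _) (by simp)]
    simpa using main j

theorem drift {S : Type*} (P : S → S → ℝ≥0∞) (hP : IsStochastic P)
    (lam : S → ℕ) (hlmc : IsLMC P lam)
    (pplus p : ℝ≥0∞) (N₀ : ℕ) (hdiv : Divergent P lam pplus N₀)
    (hple : pplus ≤ 1) (hp1 : 1/2 < p) (hp2 : p < pplus) (s : S) :
    ∑' s', P s s' * ((1 - p) / p) ^ (lam s' - N₀) ≤ ((1 - p) / p) ^ (lam s - N₀) := by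
  obtain ⟨q, k, rfl, hk, hq1, hq2, hkq, hk0, hk1⟩ := aux_kappa p hp1 (hp2.trans_le hple)
  rw [hk]
  have hk1' : (k : ℝ≥0∞) ≤ 1 := by
    have : k ≤ 1 := by exact_mod_cast hk1.le
    exact_mod_cast this
  rcases le_or_gt (lam s) N₀ with h | h
  · rw [Nat.sub_eq_zero_of_le h, pow_zero]
    calc _ ≤ ∑' s', P s s' * 1 :=
          ENNReal.tsum_le_tsum fun a => mul_le_mul_right (pow_le_one' hk1' _) _
      _ = 1 := by simp_rw [mul_one]; exact hP s
  have hdv := hdiv.2 s h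
  have hu : Pup P lam s = ∑' s', Set.indicator {s' | lam s < lam s'} (P s) s' :=
    tsum_subtype {s' | lam s < lam s'} (P s)
  have he : Peq P lam s = ∑' s', Set.indicator {s' | lam s' = lam s} (P s) s' :=
    tsum_subtype {s' | lam s' = lam s} (P s)
  have hd : Pdown P lam s = ∑' s', Set.indicator {s' | lam s' + 1 = lam s} (P s) s' :=
    tsum_subtype {s' | lam s' + 1 = lam s} (P s)
  have hcases : ∀ s', P s s' = 0 ∨ lam s < lam s' ∨ lam s' = lam s ∨ lam s' + 1 = lam s := by
    intro s'
    rcases eq_or_ne (P s s') 0 with h0 | h0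
    · exact Or.inl h0
    · have := hlmc.1 s s' (pos_iff_ne_zero.2 h0)
      omega
  have hsum : Pup P lam s + Peq P lam s + Pdown P lam s = 1 := by
    rw [hu, he, hd, ← ENNReal.tsum_add, ← ENNReal.tsum_add, ← hP s]
    congr 1
    ext s'
    rcases hcases s' with h0 | h0 | h0 | h0
    · simp [Set.indicator, h0]
    · simp [Set.indicator, h0, show lam s' ≠ lam s by omega, show lam s' + 1 ≠ lam s by omega]
    · simp [Set.indicator, h0]
    · simp [Set.indicator, h0, show lam s' ≠ lam s by omega, show ¬ lam s < lam s' by omega]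
  obtain ⟨j, hj⟩ := Nat.exists_eq_add_of_lt h
  have hbound : ∑' s', P s s' * (k : ℝ≥0∞) ^ (lam s' - N₀) ≤
      k ^ j * (k ^ 2 * Pup P lam s + k * Peq P lam s + Pdown P lam s) := by
    rw [hu, he, hd, ← ENNReal.tsum_mul_left, ← ENNReal.tsum_mul_left, ← ENNReal.tsum_add,
      ← ENNReal.tsum_add, ← ENNReal.tsum_mul_left]
    refine ENNReal.tsum_le_tsum fun s' => ?_
    rcases hcases s' with h0 | h0 | h0 | h0
    · simp [h0]
    · simp only [Set.indicator, Set.mem_ofPred_eq, h0, if_true,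
        show lam s' ≠ lam s by omega, show lam s' + 1 ≠ lam s by omega, if_false, mul_zero,
        add_zero]
      rw [mul_comm, ← mul_assoc, ← pow_add]
      exact mul_le_mul_left (pow_le_pow_right_of_le_one' hk1' (by omega)) _
    · simp only [Set.indicator, Set.mem_ofPred_eq, h0, if_true, lt_irrefl,
        show lam s + 1 ≠ lam s by omega, if_false, mul_zero,
        add_zero, zero_add]
      rw [mul_comm, ← mul_assoc, ← pow_succ]
      exact mul_le_mul_left (pow_le_pow_right_of_le_one' hk1' (by omega)) _
    · simp only [Set.indicator, Set.mem_ofPred_eq, h0, if_true,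
        show lam s' ≠ lam s by omega, show ¬ lam s < lam s' by omega, if_false, mul_zero,
        add_zero, zero_add]
      rw [mul_comm]
      exact mul_le_mul_left (pow_le_pow_right_of_le_one' hk1' (by omega)) _
  refine hbound.trans ?_
  have e2 : lam s - N₀ = j + 1 := by omega
  rw [e2, pow_succ (k : ℝ≥0∞) j]
  refine mul_le_mul_right ?_ _
  have hpq : (q : ℝ≥0∞) * (Pdown P lam s + Pup P lam s) ≤ Pup P lam s := by
    rcases lt_or_ge (Peq P lam s) 1 with h1 | h1
    · exact ENNReal.mul_le_of_le_div (hp2.le.trans (hdv h1))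
    · have : Peq P lam s = 1 := le_antisymm (by rw [← hsum]; exact le_add_right le_add_self) h1
      have h3 : 1 + (Pup P lam s + Pdown P lam s) = 1 + 0 := by
        rw [add_zero]; nth_rewrite 2 [← hsum]; rw [this]; ring
      have h4 := (ENNReal.add_right_inj ENNReal.one_ne_top).1 h3
      rw [add_comm, h4]; simp
  clear hu he hd hbound hdv
  generalize Pup P lam s = u at *
  generalize Peq P lam s = e at *
  generalize Pdown P lam s = d at *
  have fu : u ≠ ⊤ := by rintro rfl; simp at hsum
  have fe : e ≠ ⊤ := by rintro rfl; simp at hsum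
  have fd : d ≠ ⊤ := by rintro rfl; simp at hsum
  lift u to ℝ≥0 using fu
  lift e to ℝ≥0 using fe
  lift d to ℝ≥0 using fd
  norm_cast at hsum hpq ⊢
  rw [← NNReal.coe_le_coe] at hpq ⊢
  rw [← NNReal.coe_inj] at hsum
  push_cast at hsum hpq ⊢
  have hx : 0 ≤ (k : ℝ) * u - d := by
    have : 0 ≤ (q : ℝ) * (k * u - d) := by nlinarith
    by_contra hc
    nlinarith
  nlinarith [mul_nonneg (sub_nonneg.2 hk1.le) hx]

/-- iterated killed operator tends to zero for functions vanishing at high levels -/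
theorem iter_bound {S : Type*} (P : S → S → ℝ≥0∞) (F T : Set S) (hFT : F ⊆ T)
    (hP : IsStochastic P) (B : Finset S) (c : S → ℝ≥0∞) (m : S → ℕ) (ε : ℝ≥0∞)
    (φ : ℕ → S → ℝ≥0∞) (hφ : ∀ n, φ (n + 1) = stepK P T (φ n))
    (h0 : ∀ s, φ 0 s ≤ ε + ∑ b ∈ B, c b * hitAt P F (m b) s) (n : ℕ) :
    ∀ s, φ n s ≤ ε + ∑ b ∈ B, c b * hitAt P F (n + m b) s := by
  induction n with
  | zero => simpa using h0
  | succ n ih =>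
    intro s
    rw [hφ]
    unfold stepK
    split_ifs with h
    · simp
    have hF : s ∉ F := fun h' => h (hFT h')
    calc ∑' s', P s s' * φ n s'
        ≤ ∑' s', (P s s' * ε + ∑ b ∈ B, c b * (P s s' * hitAt P F (n + m b) s')) := by
          refine ENNReal.tsum_le_tsum fun s' => ?_
          refine (mul_le_mul_right (ih s') _).trans (le_of_eq ?_)
          rw [mul_add, Finset.mul_sum]
          congr 1
          refine Finset.sum_congr rfl fun b _ => ?_
          ring
      _ = ε + ∑ b ∈ B, c b * hitAt P F (n + 1 + m b) s := by
          rw [ENNReal.tsum_add, ENNReal.tsum_mul_right, hP s, one_mul,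
            Summable.tsum_finsetSum (fun _ _ => ENNReal.summable)]
          congr 1
          refine Finset.sum_congr rfl fun b _ => ?_
          rw [ENNReal.tsum_mul_left, show n + 1 + m b = n + m b + 1 by ring]
          simp [hitAt, stepK, hF]

theorem iter_tendsto {S : Type*} (P : S → S → ℝ≥0∞) (hP : IsStochastic P)
    (lam : S → ℕ) (hfin : ∀ n : ℕ, {s : S | lam s = n}.Finite) (F : Set S)
    (k : ℝ≥0∞) (hk : k < 1) (N₀ : ℕ)
    (φ : ℕ → S → ℝ≥0∞) (hφ : ∀ n, φ (n + 1) = stepK P (F ∪ Av P F) (φ n))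
    (h0 : ∀ s, φ 0 s ≤ k ^ (lam s - N₀)) (h0' : ∀ s ∈ F ∪ Av P F, φ 0 s = 0) (s : S) :
    Tendsto (fun n => φ n s) atTop (nhds 0) := by
  rw [ENNReal.tendsto_nhds_zero]
  intro ε hε
  have hpow := ENNReal.tendsto_pow_atTop_nhds_zero_of_lt_one hk
  rw [ENNReal.tendsto_nhds_zero] at hpow
  obtain ⟨N, hN⟩ := (hpow (ε / 2) (ENNReal.half_pos hε.ne')).exists
  have hBfin : {b : S | lam b ≤ N₀ + N ∧ b ∉ F ∪ Av P F}.Finite := by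
    refine Set.Finite.subset (Set.Finite.biUnion (Set.finite_Iic (N₀ + N)) fun n _ => hfin n) ?_
    intro b hb
    simp only [Set.mem_iUnion]
    exact ⟨lam b, hb.1, rfl⟩
  have hex : ∀ b : S, ∃ m, b ∉ F ∪ Av P F → hitAt P F m b ≠ 0 := by
    intro b
    by_cases hb : b ∈ F ∪ Av P F
    · exact ⟨0, fun h => absurd hb h⟩
    · have h1 : reachProb P F b ≠ 0 := fun h => hb (Or.inr h)
      rw [reach_eq] at h1
      by_contra! hcon
      exact h1 (ENNReal.tsum_eq_zero.2 fun m => (hcon m).2)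
  choose m hm using hex
  have hhit1 : ∀ n x, hitAt P F n x ≤ 1 := by
    intro n x
    refine le_trans ?_ (reach_le_one P hP F x)
    rw [reach_eq]
    exact ENNReal.le_tsum n
  set B := hBfin.toFinset
  have hb := iter_bound P F (F ∪ Av P F) Set.subset_union_left hP B
    (fun b => (hitAt P F (m b) b)⁻¹) m (k ^ N) φ hφ
    (by
      intro x
      by_cases hx : x ∈ F ∪ Av P F
      · rw [h0' x hx]; exact zero_le
      rcases le_or_gt (lam x) (N₀ + N) with h | h
      · have hxB : x ∈ B := by
          rw [Set.Finite.mem_toFinset]; exact ⟨h, hx⟩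
        refine le_trans ?_ le_add_self
        refine le_trans ?_ (Finset.single_le_sum (f := fun b => (hitAt P F (m b) b)⁻¹ * hitAt P F (m b) x)
          (fun _ _ => zero_le) hxB)
        rw [ENNReal.inv_mul_cancel (hm x hx) (ne_top_of_le_ne_top ENNReal.one_ne_top (hhit1 _ _))]
        exact (h0 x).trans (pow_le_one' hk.le _)
      · refine le_trans ((h0 x).trans ?_) le_self_add
        exact pow_le_pow_right_of_le_one' hk.le (by omega))
  have hlim : Tendsto (fun n => ∑ b ∈ B, (hitAt P F (m b) b)⁻¹ * hitAt P F (n + m b) s) atTop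
      (nhds 0) := by
    have : (0 : ℝ≥0∞) = ∑ b ∈ B, (hitAt P F (m b) b)⁻¹ * 0 := by simp
    rw [this]
    refine tendsto_finsetSum _ fun b hbB => ?_
    have hbx : b ∉ F ∪ Av P F := ((Set.Finite.mem_toFinset _).1 hbB).2
    refine ENNReal.Tendsto.const_mul ?_ (Or.inr (ENNReal.inv_ne_top.2 (hm b hbx)))
    have h1 : Tendsto (fun n => hitAt P F n s) atTop (nhds 0) := by
      apply ENNReal.tendsto_atTop_zero_of_tsum_ne_top
      rw [← reach_eq]
      exact ne_top_of_le_ne_top ENNReal.one_ne_top (reach_le_one P hP F s)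
    exact h1.comp (tendsto_add_atTop_nat (m b))
  rw [ENNReal.tendsto_nhds_zero] at hlim
  filter_upwards [hlim (ε / 2) (ENNReal.half_pos hε.ne')] with n hn
  refine (hb n s).trans ?_
  rw [← ENNReal.add_halves ε]
  exact add_le_add hN hn

end Helpers

section Thms

variable {S : Type*}

theorem stmt14 [Countable S] (P : S → S → ℝ≥0∞) (hP : IsStochastic P)
    (lam : S → ℕ) (hlmc : IsLMC P lam)
    (pplus p : ℝ≥0∞) (N₀ : ℕ) (hdiv : Divergent P lam pplus N₀)
    (hple : pplus ≤ 1) (hp1 : 1/2 < p) (hp2 : p < pplus) :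
    ∃ N₁ : ℕ, N₀ ≤ N₁ ∧
      (let F : Set S := {s : S | lam s ≤ N₀}
       let bk := biasedKernel P F (walkKernel p) (Set.Iic N₀)
         (fun s => lam s.val)
       let R : Set (Option (SA P F)) :=
         {x | x = none ∨ ∃ s : SA P F, x = some s ∧ lam s.val ≤ N₁}
       R.Finite ∧ (∀ x, reachProb bk R x = 1) ∧
       ∀ T : Set S, T ⊆ F →
         ∀ x, reachProb bk
           ({y | ∃ u : SA P F, y = some u ∧ u.val ∈ T} ∪
             Av bk {y | ∃ u : SA P F, y = some u ∧ u.val ∈ T}) x = 1) := by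
  refine ⟨N₀, le_rfl, ?_⟩
  intro F bk R
  have hplt : p < 1 := hp2.trans_le hple
  set k : ℝ≥0∞ := (1 - p) / p with hkdef
  have hr : ∀ n, reachProb (walkKernel p) (Set.Iic N₀) n = k ^ (n - N₀) :=
    walk_reach p hp1 hplt N₀
  have hdrift := drift P hP lam hlmc pplus p N₀ hdiv hple hp1 hp2
  rw [← hkdef] at hdrift
  obtain ⟨hk0, hklt⟩ : k ≠ 0 ∧ k < 1 := by
    obtain ⟨q, k', -, hk, -, -, -, h0, h1⟩ := aux_kappa p hp1 hplt
    rw [hkdef, hk]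
    have h0' : 0 < k' := by exact_mod_cast h0
    have h1' : k' < 1 := by exact_mod_cast h1
    exact ⟨by exact_mod_cast h0'.ne', by exact_mod_cast h1'⟩
  have hkn0 : ∀ n : ℕ, k ^ n ≠ 0 := fun n => pow_ne_zero n hk0
  have hknt : ∀ n : ℕ, k ^ n ≠ ⊤ := fun n => ENNReal.pow_ne_top hklt.ne_top
  have hbk : ∀ s s' : SA P F, bk (some s) (some s') =
      P s.val s'.val * k ^ (lam s'.val - N₀) / k ^ (lam s.val - N₀) := by
    intro s s'
    simp only [bk, biasedKernel, hr]
  have hratio : ∀ s : SA P F, hRatio P F (walkKernel p) (Set.Iic N₀) (fun s => lam s.val) s =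
      ∑' s', bk (some s) (some s') := by
    intro s
    simp only [hRatio, hbk, hr, div_eq_mul_inv]
    rw [ENNReal.tsum_mul_right]
  have hratio1 : ∀ s : SA P F, ∑' s', bk (some s) (some s') ≤ 1 := by
    intro s
    simp only [hbk, div_eq_mul_inv]
    rw [ENNReal.tsum_mul_right, ← div_eq_mul_inv]
    refine ENNReal.div_le_of_le_mul ?_
    rw [one_mul]
    refine le_trans ?_ (hdrift s.val)
    exact ENNReal.tsum_comp_le_tsum_of_injective Subtype.val_injective
      (fun s' => P s.val s' * k ^ (lam s' - N₀))
  have hstoch : IsStochastic bk := by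
    intro x
    rw [aux_tsum_option]
    cases x with
    | none => simp [bk, biasedKernel]
    | some s =>
      have : bk (some s) none = 1 - ∑' s', bk (some s) (some s') := by
        rw [← hratio]; rfl
      rw [this, tsub_add_cancel_of_le (hratio1 s)]
  have hfinR : R.Finite := by
    have h1 : {s : S | lam s ≤ N₀}.Finite := by
      refine Set.Finite.subset (Set.Finite.biUnion (Set.finite_Iic N₀) fun n _ => hlmc.2 n) ?_
      intro b hb
      simp only [Set.mem_iUnion]
      exact ⟨lam b, hb, rfl⟩
    have h2 : {s : SA P F | lam s.val ≤ N₀}.Finite :=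
      h1.preimage Subtype.val_injective.injOn
    refine Set.Finite.subset ((h2.image some).insert none) ?_
    rintro x (hx | ⟨s, hx, hs⟩)
    · exact Or.inl hx
    · exact Or.inr ⟨s, hs, hx.symm⟩
  have hnone : (none : Option (SA P F)) ∈ R := Or.inl rfl
  have hsome : ∀ s : SA P F, some s ∈ R ↔ s.val ∈ F ∪ Av P F := by
    intro s
    constructor
    · rintro (h | ⟨u, hu, h⟩)
      · cases h
      · cases hu; exact Or.inl h
    · rintro (h | h)
      · exact Or.inr ⟨s, rfl, h⟩
      · exact absurd h s.2
  have hsurvR : ∀ n x, x ∈ R → surv bk R n x = 0 := by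
    intro n x hx
    cases n <;> simp [surv, stepK, hx]
  -- the killed process in the original chain
  let φ : ℕ → S → ℝ≥0∞ := fun n => Nat.rec
    (fun s => if s ∈ F ∪ Av P F then 0 else k ^ (lam s - N₀))
    (fun _ f => stepK P (F ∪ Av P F) f) n
  have hφ0 : ∀ s, φ 0 s = if s ∈ F ∪ Av P F then 0 else k ^ (lam s - N₀) := fun s => rfl
  have hφs : ∀ n, φ (n + 1) = stepK P (F ∪ Av P F) (φ n) := fun n => rfl
  have hφz : ∀ n s, s ∈ F ∪ Av P F → φ n s = 0 := by
    intro n s hs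
    cases n with
    | zero => rw [hφ0, if_pos hs]
    | succ n => rw [hφs, stepK, if_pos hs]
  have hφt : ∀ s, Tendsto (fun n => φ n s) atTop (nhds 0) := by
    intro s
    refine iter_tendsto P hP lam hlmc.2 F k hklt N₀ φ hφs ?_ (hφz 0) s
    intro s
    rw [hφ0]
    split_ifs
    · exact zero_le
    · exact le_rfl
  have hconn : ∀ n (s : SA P F), surv bk R n (some s) = φ n s.val / k ^ (lam s.val - N₀) := by
    intro n
    induction n with
    | zero =>
      intro s
      simp only [surv, hφ0, hsome]
      split_ifs
      · simp
      · rw [ENNReal.div_self (hkn0 _) (hknt _)]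
    | succ n ih =>
      intro s
      rw [hφs]
      simp only [surv, stepK, hsome]
      split_ifs with h
      · simp
      · rw [aux_tsum_option, hsurvR n none hnone, mul_zero, zero_add]
        have e1 : ∑' s', P s.val s' * φ n s' = ∑' s' : SA P F, P s.val s'.val * φ n s'.val := by
          symm
          refine Function.Injective.tsum_eq (f := fun s' => P s.val s' * φ n s')
            (g := fun u : SA P F => u.val) Subtype.val_injective ?_
          intro x hx
          refine ⟨⟨x, fun hx2 => hx ?_⟩, rfl⟩
          simp [hφz n x (Or.inr hx2)]
        rw [e1, div_eq_mul_inv, ← ENNReal.tsum_mul_right]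
        congr 1
        ext s'
        rw [ih, hbk, div_eq_mul_inv, div_eq_mul_inv]
        have := ENNReal.mul_inv_cancel (hkn0 (lam s'.val - N₀)) (hknt (lam s'.val - N₀))
        calc _ = P s.val s'.val * φ n s'.val * (k ^ (lam s.val - N₀))⁻¹ *
              (k ^ (lam s'.val - N₀) * (k ^ (lam s'.val - N₀))⁻¹) := by ring
          _ = _ := by rw [this, mul_one]
  have hreach : ∀ x, reachProb bk R x = 1 := by
    intro x
    apply reach_eq_one bk hstoch
    cases x with
    | none => simp only [hsurvR _ none hnone]; exact tendsto_const_nhds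
    | some s =>
      simp only [hconn]
      have := ENNReal.Tendsto.div_const (hφt s.val) (b := k ^ (lam s.val - N₀)) (Or.inr (hkn0 _))
      simpa using this
  refine ⟨hfinR, hreach, ?_⟩
  intro T _ x
  exact decisive bk hstoch R _ hfinR ⟨none, hnone⟩ hreach x

end Thms
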